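/- The polynomial F ∈ ℚ[X₀, X₁, X₂, X₃, X₆, X₇] is invariant under each of the four linear substitutions g_B, g_d, g_e, g_f: F(g·(X₀,X₁,X₂,X₃,X₆,X₇)) = F(X₀,X₁,X₂,X₃,X₆,X₇) for g ∈ {g_B, g_d, g_e, g_f}. (Hence F is invariant under the group W(E₆) they generate.) -/

import Mathlib

open MvPolynomial in
/-- The degree-10 polynomial `F = F₁₀ − X₀X₁X₂X₃X₆X₇·F₄` defining the Picard modular
fourfold `𝒳 ⊂ P⁵`. The variables `X 0, X 1, X 2, X 3, X 4, X 5` stand for the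
coordinates `X₀, X₁, X₂, X₃, X₆, X₇`, and `Sᵢ` is the `i`-th elementary symmetric
polynomial in the five squares `X₁², X₂², X₃², X₆², X₇²`. -/
noncomputable def Fpoly : MvPolynomial (Fin 6) ℚ :=
  let a := X 1 ^ 2; let b := X 2 ^ 2; let c := X 3 ^ 2; let d := X 4 ^ 2; let e := X 5 ^ 2
  let S1 := a + b + c + d + e
  let S2 := a*b + a*c + a*d + a*e + b*c + b*d + b*e + c*d + c*e + d*e
  let S3 := a*b*c + a*b*d + a*b*e + a*c*d + a*c*e + a*d*e + b*c*d + b*c*e + b*d*e + c*d*e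
  let S4 := a*b*c*d + a*b*c*e + a*b*d*e + a*c*d*e + b*c*d*e
  let S5 := a*b*c*d*e
  let F4 := -6*S1^2 + 16*S2 + 4*S1*(X 0)^2 + 2*(X 0)^4
  let F10 := S1*S2^2 - 3*S1^2*S3 + 12*S1*S4 - 48*S5 + (-S2^2 + 2*S1*S3 + 4*S4)*(X 0)^2
      + S3*(X 0)^4
  F10 - X 0 * X 1 * X 2 * X 3 * X 4 * X 5 * F4

/-- `g_B` swaps the last two coordinates `X₆, X₇` and fixes the other coordinates. -/
def gB : Matrix (Fin 6) (Fin 6) ℚ :=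
  !![1,0,0,0,0,0; 0,1,0,0,0,0; 0,0,1,0,0,0; 0,0,0,1,0,0; 0,0,0,0,0,1; 0,0,0,0,1,0]

/-- `g_d = diag(1, 1, −1, −1, −1, −1)`. -/
def gd : Matrix (Fin 6) (Fin 6) ℚ := Matrix.diagonal ![1, 1, -1, -1, -1, -1]

/-- `g_e = diag(1, 1, 1, −1, −1, 1)`. -/
def ge : Matrix (Fin 6) (Fin 6) ℚ := Matrix.diagonal ![1, 1, 1, -1, -1, 1]

/-- `g_f`, acting on column vectors. -/
def gf : Matrix (Fin 6) (Fin 6) ℚ :=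
  (1/4 : ℚ) • !![1,3,3,3,3,3; 1,-1,3,-1,-1,-1; 1,3,-1,-1,-1,-1;
                 1,-1,-1,3,-1,-1; 1,-1,-1,-1,-1,3; 1,-1,-1,-1,3,-1]

section Invariance

variable {R : Type*} [CommRing R]

/-- The value of `Fpoly` at a point, written in terms of `x₀` and the elementary symmetric
functions of the remaining five coordinates. -/
def esymmForm (u e₁ e₂ e₃ e₄ e₅ : R) : R :=
  let S1 := e₁ ^ 2 - 2 * e₂
  let S2 := e₂ ^ 2 - 2 * e₁ * e₃ + 2 * e₄
  let S3 := e₃ ^ 2 - 2 * e₂ * e₄ + 2 * e₁ * e₅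
  let S4 := e₄ ^ 2 - 2 * e₃ * e₅
  let S5 := e₅ ^ 2
  S1 * S2 ^ 2 - 3 * S1 ^ 2 * S3 + 12 * S1 * S4 - 48 * S5
    + (-S2 ^ 2 + 2 * S1 * S3 + 4 * S4) * u ^ 2 + S3 * u ^ 4
    - u * e₅ * (-6 * S1 ^ 2 + 16 * S2 + 4 * S1 * u ^ 2 + 2 * u ^ 4)

/-- The reflection `x₀ ↦ x₀ - 3t`, `xᵢ ↦ xᵢ + t` with `4t = x₀ - x₁ - ⋯ - x₅`, on the level of
elementary symmetric functions. -/
lemma esymmForm_shift (t e₁ e₂ e₃ e₄ e₅ : R) :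
    esymmForm (e₁ + t) (e₁ + 5 * t) (e₂ + 4 * t * e₁ + 10 * t ^ 2)
      (e₃ + 3 * t * e₂ + 6 * t ^ 2 * e₁ + 10 * t ^ 3)
      (e₄ + 2 * t * e₃ + 3 * t ^ 2 * e₂ + 4 * t ^ 3 * e₁ + 5 * t ^ 4)
      (e₅ + t * e₄ + t ^ 2 * e₃ + t ^ 3 * e₂ + t ^ 4 * e₁ + t ^ 5) =
    esymmForm (e₁ + 4 * t) e₁ e₂ e₃ e₄ e₅ := by
  simp only [esymmForm]
  ring

/-- `esymmForm` evaluated at the elementary symmetric functions of five elements. -/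
def pointForm (u a b c d e : R) : R :=
  esymmForm u (a + b + c + d + e)
    (a*b + a*c + a*d + a*e + b*c + b*d + b*e + c*d + c*e + d*e)
    (a*b*c + a*b*d + a*b*e + a*c*d + a*c*e + a*d*e + b*c*d + b*c*e + b*d*e + c*d*e)
    (a*b*c*d + a*b*c*e + a*b*d*e + a*c*d*e + b*c*d*e)
    (a*b*c*d*e)

lemma pointForm_swap_last (u a b c d e : R) :
    pointForm u a b c e d = pointForm u a b c d e := by
  unfold pointForm
  congr 1 <;> ring

lemma pointForm_swap_first (u a b c d e : R) :
    pointForm u b a c d e = pointForm u a b c d e := by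
  unfold pointForm
  congr 1 <;> ring

lemma pointForm_reflect (t a b c d e : R) :
    pointForm (a + b + c + d + e + t) (a + t) (b + t) (c + t) (d + t) (e + t) =
      pointForm (a + b + c + d + e + 4 * t) a b c d e := by
  unfold pointForm
  rw [← esymmForm_shift]
  congr 1 <;> ring

/-- `pointForm` in terms of the elementary symmetric functions of the squares. -/
lemma pointForm_eq (u x₁ x₂ x₃ x₄ x₅ : R) :
    pointForm u x₁ x₂ x₃ x₄ x₅ =
      (let a := x₁ ^ 2; let b := x₂ ^ 2; let c := x₃ ^ 2; let d := x₄ ^ 2; let e := x₅ ^ 2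
      let S1 := a + b + c + d + e
      let S2 := a*b + a*c + a*d + a*e + b*c + b*d + b*e + c*d + c*e + d*e
      let S3 := a*b*c + a*b*d + a*b*e + a*c*d + a*c*e + a*d*e + b*c*d + b*c*e + b*d*e + c*d*e
      let S4 := a*b*c*d + a*b*c*e + a*b*d*e + a*c*d*e + b*c*d*e
      let S5 := a*b*c*d*e
      let F4 := -6*S1^2 + 16*S2 + 4*S1*u^2 + 2*u^4
      let F10 := S1*S2^2 - 3*S1^2*S3 + 12*S1*S4 - 48*S5 + (-S2^2 + 2*S1*S3 + 4*S4)*u^2 + S3*u^4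
      F10 - u * x₁ * x₂ * x₃ * x₄ * x₅ * F4) := by
  have key : ∀ S1 S2 S3 S4 S5 p T1 T2 T3 T4 T5 q : R, S1 = T1 → S2 = T2 → S3 = T3 → S4 = T4 →
      S5 = T5 → p = q →
      S1 * S2 ^ 2 - 3 * S1 ^ 2 * S3 + 12 * S1 * S4 - 48 * S5
        + (-S2 ^ 2 + 2 * S1 * S3 + 4 * S4) * u ^ 2 + S3 * u ^ 4
        - p * (-6 * S1 ^ 2 + 16 * S2 + 4 * S1 * u ^ 2 + 2 * u ^ 4) =
      T1 * T2 ^ 2 - 3 * T1 ^ 2 * T3 + 12 * T1 * T4 - 48 * T5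
        + (-T2 ^ 2 + 2 * T1 * T3 + 4 * T4) * u ^ 2 + T3 * u ^ 4
        - q * (-6 * T1 ^ 2 + 16 * T2 + 4 * T1 * u ^ 2 + 2 * u ^ 4) := by
    rintro _ _ _ _ _ _ _ _ _ _ _ _ rfl rfl rfl rfl rfl rfl
    rfl
  apply key <;> ring

/-- `pointForm` is unchanged when the signs of two coordinates are changed. -/
lemma pointForm_neg_mid (u a b c d e : R) :
    pointForm u a b (-c) (-d) e = pointForm u a b c d e := by
  simp only [pointForm_eq, neg_sq, mul_neg, neg_mul, neg_neg]

lemma pointForm_neg_last_four (u a b c d e : R) :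
    pointForm u a (-b) (-c) (-d) (-e) = pointForm u a b c d e := by
  simp only [pointForm_eq, neg_sq, mul_neg, neg_mul, neg_neg]

lemma pointForm_quarter_reflect {q : R} (hq : 4 * q = 1) (u a b c d e : R) :
    pointForm (q * u + 3 * q * a + 3 * q * b + 3 * q * c + 3 * q * d + 3 * q * e)
      (q * u + -q * a + 3 * q * b + -q * c + -q * d + -q * e)
      (q * u + 3 * q * a + -q * b + -q * c + -q * d + -q * e)
      (q * u + -q * a + -q * b + 3 * q * c + -q * d + -q * e)
      (q * u + -q * a + -q * b + -q * c + -q * d + 3 * q * e)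
      (q * u + -q * a + -q * b + -q * c + 3 * q * d + -q * e) =
    pointForm u a b c d e := by
  have h := pointForm_reflect (q * (u - a - b - c - d - e)) a b c d e
  rw [← pointForm_swap_first, ← pointForm_swap_last] at h
  convert h using 2
  · linear_combination (a + b + c + d + e) * hq
  · linear_combination b * hq
  · linear_combination a * hq
  · linear_combination c * hq
  · linear_combination e * hq
  · linear_combination d * hq
  · linear_combination (-(u - a - b - c - d - e)) * hq

end Invariance

open MvPolynomial in
lemma aeval_Fpoly {A : Type*} [CommRing A] [Algebra ℚ A] (f : Fin 6 → A) :
    aeval f Fpoly = pointForm (f 0) (f 1) (f 2) (f 3) (f 4) (f 5) := by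
  rw [pointForm_eq]
  simp only [Fpoly, map_sub, map_add, map_mul, map_neg, map_pow, aeval_X, map_ofNat]

open MvPolynomial in
lemma Fpoly_eq_pointForm : Fpoly = pointForm (X 0) (X 1) (X 2) (X 3) (X 4) (X 5) := by
  rw [← aeval_Fpoly, aeval_X_left_apply]

open MvPolynomial in
/-- `F` is invariant under each of the linear substitutions `g_B, g_d, g_e, g_f`
(substituting `Xᵢ ↦ Σⱼ gᵢⱼ Xⱼ`); hence `F` is invariant under the group `W(E₆)`
they generate. -/
theorem stmt_8 :
    ∀ g ∈ ({gB, gd, ge, gf} : Set (Matrix (Fin 6) (Fin 6) ℚ)),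
      aeval (fun i => ∑ j, C (g i j) * X j) Fpoly = Fpoly := by
  intro g hg
  rw [aeval_Fpoly, Fpoly_eq_pointForm]
  simp only [Set.mem_insert_iff, Set.mem_singleton_iff] at hg
  rcases hg with rfl | rfl | rfl | rfl
  · rw [← pointForm_swap_last]
    simp [gB, Fin.sum_univ_six]
  · rw [← pointForm_neg_last_four]
    simp [gd, Fin.sum_univ_six, Matrix.diagonal_apply]
  · rw [← pointForm_neg_mid]
    simp [ge, Fin.sum_univ_six, Matrix.diagonal_apply]
  · have h1 : (C (1 / 4 * 1) : MvPolynomial (Fin 6) ℚ) = C (1 / 4) := by norm_num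
    have h3 : (C (1 / 4 * 3) : MvPolynomial (Fin 6) ℚ) = 3 * C (1 / 4) := by
      rw [mul_comm, C_mul]; rfl
    have hn : (C (1 / 4 * -1) : MvPolynomial (Fin 6) ℚ) = -C (1 / 4) := by
      rw [← C_neg]; norm_num
    have h4 : 4 * (C (1 / 4) : MvPolynomial (Fin 6) ℚ) = 1 := by
      rw [show (4 : MvPolynomial (Fin 6) ℚ) = C 4 from rfl, ← C_mul, ← C_1]; norm_num
    simp only [gf, Fin.sum_univ_six, Matrix.smul_apply, smul_eq_mul, Matrix.of_apply,
      Matrix.cons_val, h1, h3, hn]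
    exact pointForm_quarter_reflect h4 _ _ _ _ _ _
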